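/- arXiv:math/0406581 — 2 statements merged into one kernel-verified Lean document; each statement's English description precedes it below -/
import Mathlib

section
/- A sequence of epimorphisms between finitely generated fully residually free groups eventually stabilizes: if (Gₙ) is a sequence of finitely generated fully residually free groups and fₙ : Gₙ → Gₙ₊₁ is a surjective group homomorphism for each n, then there exists N such that for all n ≥ N the homomorphism fₙ is injective (hence an isomorphism). -/
def FullyResiduallyFree (G : Type) [Group G] : Prop :=
  ∀ (k : ℕ) (g : Fin k → G), (∀ i, g i ≠ 1) →
    ∃ (α : Type) (φ : G →* FreeGroup α), ∀ i, φ (g i) ≠ 1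

open Polynomial in
/-- The transvection `1 + m t v wᵀ` with `v = (1, x)` and `w = (x, -1)`, over `R[t]`. -/
noncomputable def transvectionHom {R : Type*} [CommRing R] (x : R) :
    Multiplicative ℤ →* Matrix (Fin 2) (Fin 2) R[X] where
  toFun m := 1 + ((m.toAdd : R[X]) * X) • !![C x, -1; C x * C x, -C x]
  map_one' := by simp
  map_mul' m n := by
    ext1 i j
    fin_cases i <;> fin_cases j <;>
      simp [Matrix.mul_apply, Fin.sum_univ_two] <;> ring

open Polynomial in
theorem transvectionHom_mulVec {R : Type*} [CommRing R] (x : R) (m : Multiplicative ℤ)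
    (u : Fin 2 → R[X]) :
    (transvectionHom x m).mulVec u =
      u + ((m.toAdd : R[X]) * X * (C x * u 0 - u 1)) • ![1, C x] := by
  ext1 i
  fin_cases i <;>
    simp [transvectionHom, Matrix.mulVec, dotProduct, Fin.sum_univ_two] <;> ring

open Polynomial in
/-- Applying a reduced product of `k` transvections to `(0, 1)` gives a vector of degree `k`
whose leading coefficient is a nonzero multiple of `(1, x)`, `x` being the parameter of the
first factor. -/
theorem transvectionHom_list_prod_mulVec {R ι : Type*} [CommRing R] [IsDomain R] [CharZero R]
    {x : ι → R} (hx : Function.Injective x) (l : List (Σ _ : ι, Multiplicative ℤ))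
    (hne : ∀ p ∈ l, p.2 ≠ 1) (hl : l.IsChain (fun p q => p.1 ≠ q.1)) :
    ∃ u : Fin 2 → R[X],
      ((l.map fun p => transvectionHom (x p.1) p.2).prod).mulVec ![0, 1] = u ∧
      (∀ i, (u i).natDegree ≤ l.length) ∧
      ∀ y : R, (∀ p ∈ l.head?, x p.1 ≠ y) → (C y * u 0 - u 1).coeff l.length ≠ 0 := by
  induction l with
  | nil =>
    refine ⟨![0, 1], by simp, ?_, ?_⟩
    · intro i
      fin_cases i <;> simp
    · simp
  | cons p l ih =>
    obtain ⟨u, hu, hdeg, hcoeff⟩ :=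
      ih (fun q hq => hne q (List.mem_cons_of_mem _ hq)) (List.isChain_cons.1 hl).2
    have hm : ((Multiplicative.toAdd p.2 : ℤ) : R) ≠ 0 := by
      simpa using hne p List.mem_cons_self
    have hlead := hcoeff (x p.1) fun q hq h => (List.isChain_cons.1 hl).1 q hq (hx h).symm
    have hdeg' : ∀ y : R, (C y * u 0 - u 1).natDegree ≤ l.length := fun y =>
      (natDegree_sub_le_of_le ((natDegree_C_mul_le _ _).trans (hdeg 0)) (hdeg 1)).trans
        (max_self _).le
    have hprod : (((p.2.toAdd : ℤ) : R[X]) * X * (C (x p.1) * u 0 - u 1)).natDegree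
        ≤ l.length + 1 := by
      have h : (((p.2.toAdd : ℤ) : R[X]) * X).natDegree ≤ 0 + 1 :=
        natDegree_mul_le_of_le (natDegree_intCast _).le natDegree_X_le
      have := natDegree_mul_le_of_le h (hdeg' (x p.1))
      omega
    refine ⟨_, by rw [List.map_cons, List.prod_cons, ← Matrix.mulVec_mulVec, hu,
      transvectionHom_mulVec], ?_, ?_⟩
    · intro i
      refine natDegree_add_le_of_degree_le ((hdeg i).trans (by simp)) ?_
      have hv : (![1, C (x p.1)] i : R[X]).natDegree ≤ 0 := by
        fin_cases i <;> simp
      exact natDegree_mul_le_of_le (m := l.length + 1) (n := 0) hprod hv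
    · intro y hy
      have hy' : y - x p.1 ≠ 0 := sub_ne_zero.2 (hy p (by simp)).symm
      have hzero : (C y * u 0 - u 1).coeff (l.length + 1) = 0 :=
        coeff_eq_zero_of_natDegree_lt (Nat.lt_succ_of_le (hdeg' y))
      have key : ∀ s : R[X], C y * (u + s • ![1, C (x p.1)]) 0 - (u + s • ![1, C (x p.1)]) 1
          = (C y * u 0 - u 1) + s * C (y - x p.1) := by
        intro s
        simp
        ring
      have hint : ((p.2.toAdd : ℤ) : R[X]) = C ((p.2.toAdd : ℤ) : R) := by simp
      rw [key, List.length_cons, coeff_add, hzero, zero_add, coeff_mul_C, mul_assoc, hint,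
        coeff_C_mul, coeff_X_mul]
      exact mul_ne_zero (mul_ne_zero hm hlead) hy'

open Polynomial in
theorem lift_transvectionHom_ne_one {R ι : Type*} [CommRing R] [IsDomain R] [CharZero R]
    {x : ι → R} (hx : Function.Injective x)
    {g : Monoid.CoprodI fun _ : ι => Multiplicative ℤ} (hg : g ≠ 1) :
    Monoid.CoprodI.lift (fun i => transvectionHom (x i)) g ≠ 1 := by
  classical
  obtain ⟨w, rfl⟩ := Monoid.CoprodI.Word.equiv.symm.surjective g
  change Monoid.CoprodI.lift _ w.prod ≠ 1
  intro h
  have hnil : w.toList ≠ [] := by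
    intro hw
    apply hg
    change w.prod = 1
    simp [Monoid.CoprodI.Word.prod, hw]
  obtain ⟨u, hu, -, hcoeff⟩ :=
    transvectionHom_list_prod_mulVec hx w.toList (fun p hp => w.ne_one p hp) w.chain_ne
  have hprod : (w.toList.map fun p => transvectionHom (x p.1) p.2).prod = 1 := by
    rw [← h, Monoid.CoprodI.Word.prod, map_list_prod, List.map_map]
    congr 1
  rw [hprod, Matrix.one_mulVec] at hu
  subst hu
  obtain ⟨p, l, hl⟩ := List.exists_cons_of_ne_nil hnil
  refine hcoeff (x p.1 + 1) (by simp [hl]) ?_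
  simp [hl, coeff_one]

/-- Free groups have faithful two-dimensional representations. -/
theorem FreeGroup.exists_injective_matrix_representation (α : Type*) :
    ∃ ρ : FreeGroup α →* Matrix (Fin 2) (Fin 2) (Polynomial (MvPolynomial α ℤ)),
      ∀ g, ρ g = 1 → g = 1 := by
  let e : FreeGroup α →* Monoid.CoprodI fun _ : α => Multiplicative ℤ :=
    FreeGroup.lift fun a => Monoid.CoprodI.of (i := a) (Multiplicative.ofAdd 1)
  let d : (Monoid.CoprodI fun _ : α => Multiplicative ℤ) →* FreeGroup α :=
    Monoid.CoprodI.lift fun a => zpowersHom _ (FreeGroup.of a)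
  have hde : d.comp e = MonoidHom.id _ := by
    ext a
    simp [d, e]
  refine ⟨(Monoid.CoprodI.lift fun a => transvectionHom (MvPolynomial.X a)).comp e,
    fun g hg => ?_⟩
  by_contra hne
  refine lift_transvectionHom_ne_one (MvPolynomial.X_injective (R := ℤ)) (g := e g) ?_ hg
  intro he
  apply hne
  simpa [he] using (DFunLike.congr_fun hde g).symm

/-- The universal `k`-dimensional representation of the free monoid on `ι`, sending the
generators to generic matrices. -/
noncomputable def genericRepresentation (ι : Type*) (k : ℕ) :
    FreeMonoid ι →* Matrix (Fin k) (Fin k) (MvPolynomial (ι × Fin k × Fin k) ℤ) :=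
  FreeMonoid.lift fun a => Matrix.of fun i j => MvPolynomial.X (a, i, j)

theorem exists_map_genericRepresentation {ι : Type*} {k : ℕ} {A : Type*} [CommRing A]
    (θ : FreeMonoid ι →* Matrix (Fin k) (Fin k) A) :
    ∃ e : MvPolynomial (ι × Fin k × Fin k) ℤ →+* A,
      ∀ w, θ w = e.mapMatrix (genericRepresentation ι k w) := by
  refine ⟨MvPolynomial.eval₂Hom (Int.castRingHom A) fun p => θ (FreeMonoid.of p.1) p.2.1 p.2.2,
    fun w => ?_⟩
  refine DFunLike.congr_fun (f := θ) (g := (RingHom.mapMatrix _).toMonoidHom.comp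
    (genericRepresentation ι k)) ?_ w
  ext a i j
  simp [genericRepresentation]

/-- The ideal generated by the entries of `w - 1`, for generic matrices and for the words `w`
in the kernel of `r`. -/
noncomputable def relationIdeal {ι H : Type*} [Monoid H] (k : ℕ) (r : FreeMonoid ι →* H) :
    Ideal (MvPolynomial (ι × Fin k × Fin k) ℤ) :=
  Ideal.span {p | ∃ w i j, r w = 1 ∧ p = (genericRepresentation ι k w - 1) i j}

theorem relationIdeal_mono {ι H H' : Type*} [Monoid H] [Monoid H'] (k : ℕ)
    {r : FreeMonoid ι →* H} {r' : FreeMonoid ι →* H'} (h : ∀ w, r w = 1 → r' w = 1) :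
    relationIdeal k r ≤ relationIdeal k r' := by
  refine Ideal.span_mono ?_
  rintro p ⟨w, i, j, hw, rfl⟩
  exact ⟨w, i, j, h w hw, rfl⟩

/-- A representation of `H` kills every word whose relation ideal is contained in that of `H`. -/
theorem map_eq_one_of_relationIdeal_le {ι H H' A : Type*} [Monoid H] [Monoid H'] [CommRing A]
    {k : ℕ} {r : FreeMonoid ι →* H} {r' : FreeMonoid ι →* H'}
    (h : relationIdeal k r' ≤ relationIdeal k r) (ρ : H →* Matrix (Fin k) (Fin k) A)
    {w : FreeMonoid ι} (hw : r' w = 1) : ρ (r w) = 1 := by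
  obtain ⟨e, he⟩ := exists_map_genericRepresentation (ρ.comp r)
  have hker : relationIdeal k r ≤ RingHom.ker e := by
    refine Ideal.span_le.2 ?_
    rintro p ⟨v, i, j, hv, rfl⟩
    have hv' : e.mapMatrix (genericRepresentation ι k v - 1) = 0 := by
      rw [map_sub, ← he, map_one, MonoidHom.comp_apply, hv, map_one, sub_self]
    exact congrFun (congrFun hv' i) j
  have hw' : e.mapMatrix (genericRepresentation ι k w - 1) = 0 := by
    ext i j
    exact hker (h (Ideal.subset_span ⟨w, i, j, hw, rfl⟩))
  rwa [map_sub, ← he, map_one, sub_eq_zero] at hw'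

theorem Group.FG.exists_freeMonoid_surjective (G : Type*) [Group G] (hG : Group.FG G) :
    ∃ (S : Finset G) (r : FreeMonoid S →* G), Function.Surjective r := by
  obtain ⟨S, hS⟩ := (Group.fg_iff_monoid_fg.1 hG).fg_top
  refine ⟨S, FreeMonoid.lift (fun s : S => (s : G)), ?_⟩
  rw [← MonoidHom.mrange_eq_top, FreeMonoid.mrange_lift]
  simpa using hS

/-- The maps to the terms of a sequence induced by a map to its initial term. -/
def sequenceHom {M : Type*} [Monoid M] {G : ℕ → Type*} [∀ n, Group (G n)]
    (f : ∀ n, G n →* G (n + 1)) (r : M →* G 0) : ∀ n, M →* G n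
  | 0 => r
  | n + 1 => (f n).comp (sequenceHom f r n)

theorem sequenceHom_surjective {M : Type*} [Monoid M] {G : ℕ → Type*} [∀ n, Group (G n)]
    {f : ∀ n, G n →* G (n + 1)} (hf : ∀ n, Function.Surjective (f n)) {r : M →* G 0}
    (hr : Function.Surjective r) (n : ℕ) : Function.Surjective (sequenceHom f r n) := by
  induction n with
  | zero => exact hr
  | succ n ih => exact (hf n).comp ih

theorem epimorphism_sequence_stabilizes (G : ℕ → Type) [∀ n, Group (G n)]
    (hFG : ∀ n, Group.FG (G n)) (hFRF : ∀ n, FullyResiduallyFree (G n))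
    (f : ∀ n, G n →* G (n + 1)) (hf : ∀ n, Function.Surjective (f n)) :
    ∃ N : ℕ, ∀ n ≥ N, Function.Injective (f n) := by
  obtain ⟨S, r, hr⟩ := Group.FG.exists_freeMonoid_surjective (G 0) (hFG 0)
  let I : ℕ →o Ideal (MvPolynomial (S × Fin 2 × Fin 2) ℤ) :=
    ⟨fun n => relationIdeal 2 (sequenceHom f r n), monotone_nat_of_le_succ fun n =>
      relationIdeal_mono 2 fun w hw => by simp [sequenceHom, hw]⟩
  obtain ⟨N, hN⟩ := monotone_stabilizes_iff_noetherian.2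
    (inferInstanceAs (IsNoetherianRing (MvPolynomial (S × Fin 2 × Fin 2) ℤ))) I
  refine ⟨N, fun n hn => (injective_iff_map_eq_one _).2 fun g hg => ?_⟩
  by_contra hne
  obtain ⟨w, rfl⟩ := sequenceHom_surjective hf hr n g
  obtain ⟨α, φ, hφ⟩ := hFRF n 1 (fun _ => sequenceHom f r n w) fun _ => hne
  obtain ⟨ρ, hρ⟩ := FreeGroup.exists_injective_matrix_representation α
  have hle : I (n + 1) ≤ I n := ((hN (n + 1) (by omega)).symm.trans (hN n hn)).le
  exact hφ 0 (hρ _ (map_eq_one_of_relationIdeal_le hle (ρ.comp φ) hg))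
end

section
/- Every fully residually free group is commutative transitive: if G is a fully residually free group and x, y, z are nontrivial elements of G such that x commutes with y and y commutes with z, then x commutes with z. -/
theorem FreeGroup.eq_of_commute_of {α : Type*} {a b : α}
    (h : Commute (FreeGroup.of a) (FreeGroup.of b)) : a = b := by
  classical
  have h' := congrArg FreeGroup.toWord h.eq
  simp only [FreeGroup.toWord_mul, FreeGroup.toWord_of] at h'
  simp [FreeGroup.reduce.cons] at h'
  exact h'.1

theorem IsFreeGroup.isCyclic_of_isMulCommutative (G : Type*) [Group G] [IsFreeGroup G]
    [IsMulCommutative G] : IsCyclic G := by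
  have hsub : Subsingleton (IsFreeGroup.Generators G) := ⟨fun a b ↦ by
    have h : Commute ((IsFreeGroup.toFreeGroup G).symm (FreeGroup.of a))
        ((IsFreeGroup.toFreeGroup G).symm (FreeGroup.of b)) := mul_comm' _ _
    exact FreeGroup.eq_of_commute_of (by simpa using h.map (IsFreeGroup.toFreeGroup G))⟩
  have hcyc : IsCyclic (FreeGroup (IsFreeGroup.Generators G)) := by
    cases isEmpty_or_nonempty (IsFreeGroup.Generators G) with
    | inl _ => infer_instance
    | inr _ =>
      have := uniqueOfSubsingleton (Classical.arbitrary (IsFreeGroup.Generators G))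
      infer_instance
  exact (IsFreeGroup.toFreeGroup G).isCyclic.mpr hcyc

theorem FreeGroup.exists_zpow_eq_of_commute {α : Type*} {x y : FreeGroup α}
    (h : Commute x y) : ∃ (u : FreeGroup α) (m n : ℤ), u ^ m = x ∧ u ^ n = y := by
  have hcomm : ∀ a ∈ ({x, y} : Set (FreeGroup α)), ∀ b ∈ ({x, y} : Set (FreeGroup α)),
      a * b = b * a := by
    rintro a (rfl | rfl) b (rfl | rfl)
    exacts [rfl, h.eq, h.eq.symm, rfl]
  have := Subgroup.isMulCommutative_closure hcomm
  have := IsFreeGroup.isCyclic_of_isMulCommutative (Subgroup.closure {x, y})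
  obtain ⟨u, hu⟩ := IsCyclic.exists_generator (α := Subgroup.closure {x, y})
  obtain ⟨m, hm⟩ := hu ⟨x, Subgroup.subset_closure (by simp)⟩
  obtain ⟨n, hn⟩ := hu ⟨y, Subgroup.subset_closure (by simp)⟩
  exact ⟨u, m, n, congrArg Subtype.val hm, congrArg Subtype.val hn⟩

theorem Commute.of_zpow_left {G : Type*} [Group G] [IsMulTorsionFree G] {u z : G} {n : ℤ}
    (hn : n ≠ 0) (h : Commute (u ^ n) z) : Commute u z := by
  have hconj : (z * u * z⁻¹) ^ n = u ^ n := by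
    rw [conj_zpow, ← h.eq, mul_inv_cancel_right]
  exact (mul_inv_eq_iff_eq_mul.mp (zpow_left_injective hn hconj)).symm

theorem FreeGroup.commute_trans {α : Type*} {x y z : FreeGroup α} (hy : y ≠ 1)
    (hxy : Commute x y) (hyz : Commute y z) : Commute x z := by
  obtain ⟨u, m, n, rfl, rfl⟩ := FreeGroup.exists_zpow_eq_of_commute hxy
  have hn : n ≠ 0 := by
    rintro rfl
    exact hy (zpow_zero u)
  exact (hyz.of_zpow_left hn).zpow_left m

theorem frf_commutative_transitive (G : Type) [Group G]
    (hG : FullyResiduallyFree G) :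
    ∀ x y z : G, x ≠ 1 → y ≠ 1 → z ≠ 1 →
      Commute x y → Commute y z → Commute x z := by
  intro x y z _ hy _ hxy hyz
  by_contra hxz
  have hc : x * z * (z * x)⁻¹ ≠ 1 := fun h ↦ hxz (mul_inv_eq_one.mp h)
  obtain ⟨α, φ, hφ⟩ := hG 2 ![x * z * (z * x)⁻¹, y] (Fin.forall_fin_two.mpr ⟨hc, hy⟩)
  have hφc : φ (x * z * (z * x)⁻¹) ≠ 1 := hφ 0
  have hφy : φ y ≠ 1 := hφ 1
  have h := FreeGroup.commute_trans hφy (hxy.map φ) (hyz.map φ)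
  apply hφc
  rw [map_mul, map_inv, map_mul, map_mul, h.eq, mul_inv_cancel]
end
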